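/- arXiv:2406.16401 — 3 statements merged into one kernel-verified Lean document; each statement's English description precedes it below -/
import Mathlib

section
/- For every n ≥ 1, Σ_{σ ∈ 𝔖_n} (−1)^{exc(σ)} = 0 when n is even, and Σ_{σ ∈ 𝔖_n} (−1)^{exc(σ)} = (−1)^{(n−1)/2} E_n when n is odd, where E_n is the n-th Euler number (tangent number for odd n). -/
/-- Number of excedances of a permutation. -/
def excN {n : ℕ} (σ : Equiv.Perm (Fin n)) : ℕ :=
  (Finset.univ.filter fun i : Fin n => i < σ i).card

/-- Depth of a permutation: `∑_{i : σ i > i} (σ i - i)`. -/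
def depthN {n : ℕ} (σ : Equiv.Perm (Fin n)) : ℕ :=
  ∑ i ∈ Finset.univ.filter (fun i : Fin n => i < σ i), ((σ i : ℕ) - (i : ℕ))

/-- Number of inversions of a permutation. -/
def invN {n : ℕ} (σ : Equiv.Perm (Fin n)) : ℕ :=
  (Finset.univ.filter fun p : Fin n × Fin n => p.1 < p.2 ∧ σ p.2 < σ p.1).card

/-- `σ` is alternating: `σ(1) > σ(2) < σ(3) > ⋯` (0-indexed). -/
def IsAlternating {n : ℕ} (σ : Equiv.Perm (Fin n)) : Prop :=
  ∀ i : ℕ, (h : i + 1 < n) →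
    if Even i then σ ⟨i + 1, h⟩ < σ ⟨i, Nat.lt_of_succ_lt h⟩
    else σ ⟨i, Nat.lt_of_succ_lt h⟩ < σ ⟨i + 1, h⟩

/-- The Euler number `E n`: the number of alternating permutations of `Fin n`. -/
noncomputable def eulerE (n : ℕ) : ℕ := Nat.card {σ : Equiv.Perm (Fin n) // IsAlternating σ}

open Polynomial

lemma exc_le {n : ℕ} (σ : Equiv.Perm (Fin n)) : excN σ ≤ n := by
  unfold excN
  exact (Finset.card_le_univ _).trans (by simp)

lemma exc_zero {n : ℕ} (e : Equiv.Perm (Fin n)) :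
    excN (Equiv.Perm.decomposeFin.symm (0, e)) = excN e := by
  unfold excN
  rw [Fin.univ_succ, Finset.filter_cons]
  simp [Finset.filter_map, Function.comp_def]

lemma exc_succ {n : ℕ} (e : Equiv.Perm (Fin n)) (i : Fin n) :
    excN (Equiv.Perm.decomposeFin.symm ((e i).succ, e)) =
      if i < e i then excN e else excN e + 1 := by
  have key : ∀ x : Fin n, (x.succ < Equiv.Perm.decomposeFin.symm ((e i).succ, e) x.succ) ↔
      (x ≠ i ∧ x < e x) := by
    intro x
    rw [Equiv.Perm.decomposeFin_symm_apply_succ]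
    by_cases h : x = i
    · subst h; simp
    · rw [Equiv.swap_apply_of_ne_of_ne (Fin.succ_ne_zero _)]
      · simp [h]
      · intro h'; exact h (e.injective (Fin.succ_injective _ h'))
  unfold excN
  rw [Fin.univ_succ, Finset.filter_cons]
  simp only [Equiv.Perm.decomposeFin_symm_apply_zero, Fin.succ_pos, if_true,
    Finset.filter_map, Finset.card_cons, Finset.card_map, Function.comp_def,
    Function.Embedding.coeFn_mk, Fin.coe_succEmb, key]
  have h2 : (Finset.univ.filter fun x : Fin n => x ≠ i ∧ x < e x) =
      (Finset.univ.filter fun x : Fin n => x < e x).erase i := by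
    ext x; simp
  rw [h2]
  split_ifs with h
  · rw [Finset.card_erase_add_one]; simpa using h
  · rw [Finset.erase_eq_of_notMem]; simpa using h

lemma sum_exc_succ {n : ℕ} (f : ℕ → ℤ[X]) :
    ∑ σ : Equiv.Perm (Fin (n+1)), f (excN σ) =
      ∑ e : Equiv.Perm (Fin n), (((excN e : ℕ) + 1) * f (excN e) +
        ((n - excN e : ℕ) : ℤ[X]) * f (excN e + 1)) := by
  rw [← Equiv.sum_comp (Equiv.Perm.decomposeFin.symm), Fintype.sum_prod_type_right]
  refine Finset.sum_congr rfl fun e _ => ?_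
  rw [Fin.sum_univ_succ, exc_zero, ← Equiv.sum_comp e]
  simp only [exc_succ]
  have : ∀ i, f (if i < e i then excN e else excN e + 1) =
    if i < e i then f (excN e) else f (excN e + 1) := fun i => by split_ifs <;> rfl
  simp only [this]
  rw [Finset.sum_ite, Finset.sum_const, Finset.sum_const]
  have h1 : (Finset.univ.filter fun i : Fin n => i < e i).card = excN e := rfl
  have h2 : (Finset.univ.filter fun i : Fin n => ¬ i < e i).card = n - excN e := by
    have := Finset.card_filter_add_card_filter_not (s := (Finset.univ : Finset (Fin n))) (fun i => i < e i)
    rw [h1] at this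
    simp only [Finset.card_univ, Fintype.card_fin] at this
    omega
  rw [h1, h2]
  simp only [nsmul_eq_mul]
  ring

/-- the polynomial refinement -/
noncomputable def RR (n : ℕ) : ℤ[X] :=
  ∑ σ : Equiv.Perm (Fin n), (-1) ^ excN σ * (1 + X) ^ (excN σ + 1) * (1 - X) ^ (n - excN σ)

lemma RR_zero : RR 0 = 1 + X := by
  simp [RR, excN]

lemma RR_succ (n : ℕ) : RR (n+1) = (1 - X^2) * derivative (RR n) := by
  unfold RR
  rw [sum_exc_succ (fun e => (-1) ^ e * (1 + X) ^ (e + 1) * (1 - X) ^ (n + 1 - e)),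
    derivative_sum, Finset.mul_sum]
  refine Finset.sum_congr rfl fun e _ => ?_
  have hle := exc_le e
  generalize excN e = k at *
  obtain ⟨m, rfl⟩ := Nat.exists_eq_add_of_le hle
  have h0 : derivative ((-1 : ℤ[X]) ^ k) = 0 := by
    rcases Nat.even_or_odd k with h | h <;> simp [h.neg_one_pow]
  have e1 : k + m - k = m := by omega
  have e2 : k + m + 1 - k = m + 1 := by omega
  have e3 : k + m + 1 - (k+1) = m := by omega
  rw [e1, e2, e3]
  simp only [derivative_mul, h0, derivative_pow, derivative_add, derivative_sub, derivative_one,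
    derivative_X]
  rcases m with _ | m
  · simp; ring
  · simp; ring

lemma RR_eval (n : ℕ) : (RR n).eval 0 = ∑ σ : Equiv.Perm (Fin n), ((-1 : ℤ)) ^ excN σ := by
  simp [RR, eval_finsetSum]

lemma deriv_even {p : ℤ[X]} (h : p.comp (-X) = p) : (derivative p).comp (-X) = - derivative p := by
  have := congrArg derivative h
  rw [derivative_comp] at this
  simp at this
  exact neg_eq_iff_eq_neg.1 this

lemma deriv_odd {p : ℤ[X]} (h : p.comp (-X) = -p) : (derivative p).comp (-X) = derivative p := by
  have := congrArg derivative h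
  rw [derivative_comp] at this
  simpa using this

lemma RR_parity (n : ℕ) : (RR (n+1)).comp (-X) = (-1)^n * RR (n+1) := by
  induction n with
  | zero => simp [RR_succ, RR_zero]
  | succ n ih =>
    rw [RR_succ (n+1)]
    rcases Nat.even_or_odd n with h | h
    · rw [h.neg_one_pow, one_mul] at ih
      simp [deriv_even ih, pow_succ, h.neg_one_pow]
    · rw [h.neg_one_pow, neg_one_mul] at ih
      simp [deriv_odd ih, pow_succ, h.neg_one_pow]

lemma eval_zero_of_odd {p : ℤ[X]} (h : p.comp (-X) = -p) : p.eval 0 = 0 := by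
  have := congrArg (eval 0) h
  simp [eval_comp] at this
  omega

lemma RR_even (n : ℕ) (h : Odd n) : (RR (n+1)).eval 0 = 0 :=
  eval_zero_of_odd (by rw [RR_parity, h.neg_one_pow, neg_one_mul])

/-- Operator of multiplication-differentiation. -/
noncomputable def LL (p : ℤ[X]) : ℤ[X] := (1 - X^2) * derivative p - X * p

lemma LL_add (p q : ℤ[X]) : LL (p + q) = LL p + LL q := by
  simp [LL]; ring

lemma LL_parity (n : ℕ) : (LL^[n] 1).comp (-X) = (-1)^n * LL^[n] 1 := by
  induction n with
  | zero => simp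
  | succ n ih =>
    rw [Function.iterate_succ_apply']
    rcases Nat.even_or_odd n with h | h
    · rw [h.neg_one_pow, one_mul] at ih
      simp [LL, deriv_even ih, ih, pow_succ, h.neg_one_pow]; ring
    · rw [h.neg_one_pow, neg_one_mul] at ih
      simp [LL, deriv_odd ih, ih, pow_succ, h.neg_one_pow]

/-- One plus the operator. -/
noncomputable def MM (p : ℤ[X]) : ℤ[X] := p + LL p

lemma MM_iter (n : ℕ) : (1 + X) * MM^[n] 1 = RR n := by
  induction n with
  | zero => simp [RR_zero]
  | succ n ih =>
    rw [Function.iterate_succ_apply', RR_succ, ← ih]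
    simp [MM, LL]; ring

/-- Seidel array. -/
noncomputable def sa (i j : ℕ) : ℤ := (MM^[i] (LL^[j] 1)).eval 0

lemma MM_LL (p : ℤ[X]) : MM (LL p) = LL (MM p) := by
  simp [MM, LL_add]

lemma sa_rec (i j : ℕ) : sa (i+1) j = sa i j + sa i (j+1) := by
  unfold sa
  rw [Function.iterate_succ_apply', MM, eval_add, Function.iterate_succ_apply' LL]
  have : Function.Commute MM LL := MM_LL
  rw [(this.iterate_left i).eq]

lemma sa_zero_odd (j : ℕ) (h : Odd j) : sa 0 j = 0 :=
  eval_zero_of_odd (by simp [LL_parity, h.neg_one_pow])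

lemma sa_eq (n : ℕ) : sa n 0 = (RR n).eval 0 := by
  rw [← MM_iter]; simp [sa]

lemma sa_zero_zero : sa 0 0 = 1 := by simp [sa]

/-- Entringer numbers. -/
noncomputable def entr (N k : ℕ) : ℕ :=
  Nat.card {σ : Equiv.Perm (Fin (N+1)) // IsAlternating σ ∧ (σ 0 : ℕ) = k}

/-- Insert a first value, complementing the rest. -/
def ins {n : ℕ} (p : Fin (n+1)) (e : Equiv.Perm (Fin n)) : Equiv.Perm (Fin (n+1)) :=
  ((finSuccEquiv' 0).trans (Equiv.optionCongr (e.trans Fin.revPerm))).trans (finSuccEquiv' p).symm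

lemma ins_zero {n : ℕ} (p : Fin (n+1)) (e : Equiv.Perm (Fin n)) : ins p e 0 = p := by
  simp [ins]

lemma ins_succ {n : ℕ} (p : Fin (n+1)) (e : Equiv.Perm (Fin n)) (i : Fin n) :
    ins p e i.succ = p.succAbove (e i).rev := by
  have h : finSuccEquiv' (0 : Fin (n+1)) i.succ = some i := by
    rw [← Fin.succAbove_zero, finSuccEquiv'_succAbove]
  simp [ins, h]

lemma ins_bij (n : ℕ) : Function.Bijective
    (fun x : Fin (n+1) × Equiv.Perm (Fin n) => ins x.1 x.2) := by
  rw [Fintype.bijective_iff_injective_and_card]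
  constructor
  · rintro ⟨p, e⟩ ⟨q, f⟩ h
    simp only at h
    have h0 := congrArg (fun s : Equiv.Perm (Fin (n+1)) => s 0) h
    simp only [ins_zero] at h0
    subst h0
    congr 1
    ext i
    have h1 := congrArg (fun s : Equiv.Perm (Fin (n+1)) => s i.succ) h
    simp only [ins_succ] at h1
    rw [Fin.rev_injective (Fin.succAbove_right_injective h1)]
  · simp [Fintype.card_perm, Nat.factorial_succ]

lemma ins_alt {N : ℕ} (p : Fin (N+2)) (e : Equiv.Perm (Fin (N+1))) :
    IsAlternating (ins p e) ↔ IsAlternating e ∧ N - (e 0 : ℕ) < p := by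
  have hs : ∀ i (h : i + 1 < N + 2), ins p e ⟨i+1, h⟩ = p.succAbove (e ⟨i, by omega⟩).rev :=
    fun i h => ins_succ p e ⟨i, by omega⟩
  have h00 : (ins p e ⟨1, by omega⟩ < ins p e ⟨0, by omega⟩) ↔ N - (e 0 : ℕ) < p := by
    rw [hs 0 (by omega)]
    have : ins p e ⟨0, by omega⟩ = p := ins_zero p e
    rw [this, Fin.succAbove_lt_iff_castSucc_lt, Fin.lt_def]
    simp [Fin.val_rev]
  constructor
  · intro H
    refine ⟨?_, ?_⟩
    · intro i h
      have := H (i+1) (by omega)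
      rw [hs, hs] at this
      simp only [Fin.succAbove_lt_succAbove_iff, Fin.rev_lt_rev] at this
      by_cases hi : Even i
      · simpa [hi, Nat.even_add_one] using this
      · simpa [hi, Nat.even_add_one] using this
    · have := H 0 (by omega)
      simp only [Even.zero, if_true] at this
      exact h00.1 this
  · rintro ⟨H, h0⟩ i h
    rcases i with _ | i
    · simp only [Even.zero, if_true]
      exact h00.2 h0
    · have := H i (by omega)
      rw [hs, hs]
      simp only [Fin.succAbove_lt_succAbove_iff, Fin.rev_lt_rev]
      by_cases hi : Even i
      · simpa [hi, Nat.even_add_one] using this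
      · simpa [hi, Nat.even_add_one] using this

lemma entr_succ (N k : ℕ) (hk : k ≤ N + 1) : entr (N+1) k =
    Nat.card {e : Equiv.Perm (Fin (N+1)) // IsAlternating e ∧ N - (e 0 : ℕ) < k} := by
  symm
  unfold entr
  refine Nat.card_congr (Equiv.ofBijective
    (fun e => ⟨ins ⟨k, by omega⟩ e.1, (ins_alt _ _).2 e.2, by rw [ins_zero]⟩) ⟨?_, ?_⟩)
  · rintro ⟨e, he⟩ ⟨f, hf⟩ h
    have h := congrArg Subtype.val h
    have := (ins_bij (N+1)).1 (a₁ := (⟨k, by omega⟩, e)) (a₂ := (⟨k, by omega⟩, f)) h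
    simpa using this
  · rintro ⟨σ, h1, h2⟩
    obtain ⟨⟨p, e⟩, rfl⟩ := (ins_bij (N+1)).2 σ
    simp only [ins_zero] at h2
    subst h2
    exact ⟨⟨e, (ins_alt _ _).1 h1⟩, rfl⟩

lemma entr_succ_zero (N : ℕ) : entr (N+1) 0 = 0 := by
  rw [entr_succ N 0 (by omega)]
  simp

lemma entr_succ_succ (N k : ℕ) (hk : k ≤ N) :
    entr (N+1) (k+1) = entr (N+1) k + entr N (N-k) := by
  classical
  rw [entr_succ N _ (by omega), entr_succ N _ (by omega), entr]
  simp only [Nat.card_eq_fintype_card, Fintype.card_subtype]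
  rw [← Finset.card_union_of_disjoint]
  · congr 1
    ext e
    have := (e 0).2
    simp only [Finset.mem_filter, Finset.mem_union, Finset.mem_univ, true_and, ← and_or_left]
    refine and_congr_right fun _ => ?_
    omega
  · rw [Finset.disjoint_left]
    intro e
    have := (e 0).2
    simp only [Finset.mem_filter, Finset.mem_univ, true_and]
    rintro ⟨_, h⟩ ⟨_, h'⟩
    omega

lemma entr_last (N : ℕ) : entr (N+1) (N+1) = eulerE (N+1) := by
  rw [entr_succ N _ le_rfl, eulerE]
  refine Nat.card_congr (Equiv.subtypeEquivRight fun e => ?_)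
  simp only [and_iff_left_iff_imp]
  intro _; omega

lemma entr_zero_zero : entr 0 0 = 1 := by
  unfold entr
  rw [Nat.card_eq_one_iff_unique]
  refine ⟨⟨fun a b => Subtype.ext (Equiv.ext fun x => Fin.ext (by have := (a.1 x).2; have := (b.1 x).2; omega))⟩, ⟨⟨1, ?_, by simp⟩⟩⟩
  intro i h; omega

lemma entr_sa (N : ℕ) : ∀ k ≤ N,
    (entr N k : ℤ) = (-1) ^ (N / 2) * (if Even N then sa (N-k) k else sa k (N-k)) := by
  induction N with
  | zero => intro k hk; obtain rfl : k = 0 := by omega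
            simp [entr_zero_zero, sa_zero_zero]
  | succ N ih =>
    intro k hk
    induction k with
    | zero =>
      rw [entr_succ_zero]
      by_cases h : Even (N+1)
      · have hN : Odd N := by rcases Nat.even_or_odd N with h' | h'
                              · exact absurd h (by simp [Nat.even_add_one, h'])
                              · exact h'
        simp [h, sa_eq, RR_even N hN]
      · simp [h, sa_zero_odd _ (Nat.not_even_iff_odd.1 h)]
    | succ k ihk =>
      rw [entr_succ_succ N k (by omega)]
      push_cast
      rw [ihk (by omega), ih (N-k) (by omega)]
      have e1 : N - (N - k) = k := by omega
      have e2 : N + 1 - (k + 1) = N - k := by omega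
      have e3 : N + 1 - k = (N - k) + 1 := by omega
      simp only [e1, e2, e3]
      rcases Nat.even_or_odd N with h | h
      · have h' : ¬ Even (N+1) := by simp [Nat.even_add_one, h]
        have h2 : (N+1)/2 = N/2 := by obtain ⟨m, rfl⟩ := h; omega
        simp only [h, h', if_true, if_false, h2, sa_rec]
        ring
      · have h' : Even (N+1) := h.add_one
        have h0 : ¬ Even N := Nat.not_even_iff_odd.2 h
        have h2 : (N+1)/2 = N/2 + 1 := by obtain ⟨m, rfl⟩ := h; omega
        simp only [h0, h', if_true, if_false, h2, sa_rec, pow_succ]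
        ring

/-- Sign-balance of excedances: `0` for even `n`, `(−1)^{(n−1)/2} E_n` for odd `n`. -/
theorem exc_sign_balance (n : ℕ) (hn : 1 ≤ n) :
    (Even n → ∑ σ : Equiv.Perm (Fin n), ((-1 : ℤ)) ^ excN σ = 0) ∧
    (Odd n → ∑ σ : Equiv.Perm (Fin n), ((-1 : ℤ)) ^ excN σ =
      (-1 : ℤ) ^ ((n - 1) / 2) * eulerE n) := by
  obtain ⟨N, rfl⟩ : ∃ N, n = N + 1 := ⟨n - 1, by omega⟩
  rw [← RR_eval]
  refine ⟨fun h => RR_even N ?_, fun h => ?_⟩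
  · rcases Nat.even_or_odd N with h' | h'
    · exact absurd h (by simp [Nat.even_add_one, h'])
    · exact h'
  · rw [← entr_last, entr_sa _ _ le_rfl, if_neg (Nat.not_even_iff_odd.2 h), Nat.sub_self, sa_eq]
    have : (N + 1 - 1) / 2 = (N + 1) / 2 := by obtain ⟨m, hm⟩ := h; omega
    rw [this, ← mul_assoc, ← pow_add, Even.neg_one_pow ⟨_, rfl⟩, one_mul]
end

section
/- For every n ≥ 1, Σ_{σ ∈ 𝔖_n} (−1)^{depth(σ)} = 0 when n is even, and equals the Euler number E_n when n is odd. -/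
namespace DSB
open PowerSeries

noncomputable section

def dd (f : ℚ⟦X⟧) : ℚ⟦X⟧ := d⁄dX ℚ f

lemma dd_add (f g : ℚ⟦X⟧) : dd (f + g) = dd f + dd g := by simp [dd]
lemma dd_sub (f g : ℚ⟦X⟧) : dd (f - g) = dd f - dd g := by simp [dd]
lemma dd_mul (f g : ℚ⟦X⟧) : dd (f * g) = f * dd g + g * dd f := by simp [dd]
lemma dd_one : dd 1 = 0 := by simp [dd]
lemma dd_smul (a : ℚ) (f : ℚ⟦X⟧) : dd (a • f) = a • dd f := by simp [dd]

abbrev ss : ℚ⟦X⟧ := PowerSeries.sin ℚ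
abbrev cc : ℚ⟦X⟧ := PowerSeries.cos ℚ

lemma dd_ss : dd ss = cc := by
  ext n
  simp only [dd, coeff_derivative, PowerSeries.sin, PowerSeries.cos, coeff_mk]
  rcases Nat.even_or_odd n with h | h
  · have h1 : ¬ Even (n+1) := by simpa [Nat.even_add_one] using h
    have h2 : (n+1)/2 = n/2 := by obtain ⟨k, rfl⟩ := h; omega
    rw [if_neg h1, if_pos h, h2, Nat.factorial_succ]
    simp only [eq_ratCast, Rat.cast_id]
    push_cast
    field_simp
  · have h1 : Even (n+1) := by simpa [Nat.even_add_one] using h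
    rw [if_pos h1, if_neg (by simpa using h)]; simp

lemma dd_cc : dd cc = -ss := by
  ext n
  simp only [dd, coeff_derivative, PowerSeries.sin, PowerSeries.cos, coeff_mk, map_neg]
  rcases Nat.even_or_odd n with h | h
  · have h1 : ¬ Even (n+1) := by simpa [Nat.even_add_one] using h
    rw [if_neg h1, if_pos h]; simp
  · have h1 : Even (n+1) := by simpa [Nat.even_add_one] using h
    have h2 : (n+1)/2 = n/2+1 := by obtain ⟨k, rfl⟩ := h; omega
    rw [if_pos h1, if_neg (by simpa using h), h2, Nat.factorial_succ]
    simp only [eq_ratCast, Rat.cast_id]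
    push_cast
    field_simp
    ring

lemma cs_ss : constantCoeff ss = 0 := by
  simp [← coeff_zero_eq_constantCoeff_apply, PowerSeries.sin]
lemma cs_cc : constantCoeff cc = 1 := by
  simp [← coeff_zero_eq_constantCoeff_apply, PowerSeries.cos]

lemma pyth : ss * ss + cc * cc = 1 := by
  apply derivative.ext
  · change dd _ = dd _
    rw [dd_add, dd_mul, dd_mul, dd_ss, dd_cc, dd_one]; ring
  · simp [cs_ss, cs_cc]

def se : ℚ⟦X⟧ := cc⁻¹
def tt : ℚ⟦X⟧ := ss * se

lemma cc_se : cc * se = 1 := PowerSeries.mul_inv_cancel _ (by simp [cs_cc])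
lemma dd_se : dd se = se * se * ss := by
  have : dd se = -se ^ 2 * dd cc := by simp [dd, se]
  rw [this, dd_cc]; ring
lemma dd_tt : dd tt = 1 + tt * tt := by
  rw [tt, dd_mul, dd_ss, dd_se]
  linear_combination cc_se
lemma cs_tt : constantCoeff tt = 0 := by simp [tt, cs_ss]
lemma cs_se : constantCoeff se = 1 := by
  have := congrArg constantCoeff cc_se
  simpa [cs_cc] using this

def ev (n : ℕ) (f : ℚ⟦X⟧) : ℚ := constantCoeff (dd^[n] f)
lemma ev_zero (f) : ev 0 f = constantCoeff f := rfl
lemma ev_succ (n f) : ev (n+1) f = ev n (dd f) := rfl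
lemma ev_add (n) : ∀ f g, ev n (f+g) = ev n f + ev n g := by
  induction n with
  | zero => intro f g; simp [ev_zero]
  | succ n ih => intro f g; rw [ev_succ, dd_add, ih]; rfl
lemma ev_smul (n) : ∀ (a : ℚ) f, ev n (a • f) = a * ev n f := by
  induction n with
  | zero => intro f g; simp [ev_zero]
  | succ n ih => intro f g; rw [ev_succ, dd_smul, ih]; rfl
lemma ev_sub (n f g) : ev n (f-g) = ev n f - ev n g := by
  have := ev_add n (f-g) g
  simp at this; linarith
lemma ev_neg (n f) : ev n (-f) = - ev n f := by
  have := ev_smul n (-1) f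
  simpa using this
lemma ev_zero' (n) : ev n 0 = 0 := by
  have := ev_smul n 0 0
  simpa using this
lemma ev_one_succ (n) : ev (n+1) 1 = 0 := by rw [ev_succ, dd_one, ev_zero']

/-- reflection -/
def rr (f : ℚ⟦X⟧) : ℚ⟦X⟧ := evalNegHom f
lemma dd_rr (f) : dd (rr f) = - rr (dd f) := by
  ext n
  simp [rr, dd, evalNegHom, coeff_derivative, coeff_rescale, pow_succ, mul_assoc]
lemma rr_mul (f g) : rr (f*g) = rr f * rr g := by simp [rr]
lemma rr_neg (f) : rr (-f) = - rr f := by simp [rr]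
lemma rr_cs (f) : constantCoeff (rr f) = constantCoeff f := by
  rw [← coeff_zero_eq_constantCoeff_apply, ← coeff_zero_eq_constantCoeff_apply, rr, evalNegHom, coeff_rescale]; simp
lemma rr_ss : rr ss = -ss := by
  ext n
  simp only [rr, evalNegHom, coeff_rescale, PowerSeries.sin, coeff_mk, map_neg]
  split_ifs with h
  · simp
  · rw [Odd.neg_one_pow (by simpa using h)]; ring
lemma rr_cc : rr cc = cc := by
  ext n
  simp only [rr, evalNegHom, coeff_rescale, PowerSeries.cos, coeff_mk]
  split_ifs with h
  · rw [Even.neg_one_pow h]; ring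
  · simp
lemma rr_se : rr se = se := by
  have h : cc * rr se = 1 := by
    rw [← rr_cc, ← rr_mul, cc_se]; simp [rr]
  linear_combination se * h - rr se * cc_se
lemma rr_tt : rr tt = -tt := by rw [tt, rr_mul, rr_ss, rr_se]; ring
lemma ev_rr (n) : ∀ f, ev n (rr f) = (-1)^n * ev n f := by
  induction n with
  | zero => intro f; simp [ev_zero, rr_cs]
  | succ n ih => intro f; rw [ev_succ, dd_rr, ev_neg, ih, ev_succ]; ring
lemma ev_se_odd (n) (h : Odd n) : ev n se = 0 := by
  have := ev_rr n se
  rw [rr_se, h.neg_one_pow] at this; linarith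
lemma ev_tt_even (n) (h : Even n) : ev n tt = 0 := by
  have := ev_rr n tt
  rw [rr_tt, h.neg_one_pow, ev_neg] at this; linarith

/-- Entringer numbers via series -/
def aa (i j : ℕ) : ℚ := ev i (cc * dd^[j] se) + ev j (ss * dd^[i] se)
lemma aa_zero (i) : aa i 0 = if i = 0 then 1 else 0 := by
  unfold aa
  simp only [Function.iterate_zero, id, cc_se, ev_zero, map_mul, cs_ss]
  cases i with
  | zero => simp [ev_zero]
  | succ n => simp [ev_one_succ]
lemma aa_succ (i j) : aa i (j+1) = aa (i+1) j + aa j i := by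
  unfold aa
  rw [ev_succ i, ev_succ j, dd_mul, dd_mul, dd_ss, dd_cc, ← Function.iterate_succ_apply' dd,
    ← Function.iterate_succ_apply' dd]
  simp only [ev_add, mul_neg, ev_neg]
  rw [mul_comm (dd^[j] se), mul_comm (dd^[i] se)]; ring
lemma aa_top (j) : aa 0 j = ev j se + ev j tt := by
  unfold aa
  simp [ev_zero, cs_cc, tt, ev]

/-- signed path counts -/
def TT : ℕ → ℕ → ℤ
  | 0, h => if h = 0 then 1 else 0
  | m+1, h => (-1)^(h+1) * TT m (h+1) + (2*h+1) * (-1)^h * TT m h - (-1)^h * h^2 * TT m (h-1)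

def ch : ℕ → ℚ
  | 0 => 1
  | h+1 => (-1)^h * (h+1) * ch h
def gg (h : ℕ) : ℚ⟦X⟧ := ch h • (tt^h + ((-1)^h : ℚ) • tt^(h+1))

lemma dd_pow (n : ℕ) : dd (tt^n) = (n:ℚ) • (tt^(n-1) * (1 + tt*tt)) := by
  have : dd (tt^n) = n * tt^(n-1) * dd tt := by simp [dd, mul_assoc]
  rw [this, dd_tt, Algebra.smul_def]; simp [mul_assoc]

lemma dd_gg (h : ℕ) : dd (gg h) = ((-1)^(h+1) : ℚ) • gg (h+1) + ((2*h+1) * (-1)^h : ℚ) • gg h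
    - ((-1)^h * h^2 : ℚ) • gg (h-1) := by
  have e2 : ∀ h : ℕ, ((-1 : ℚ⟦X⟧))^h * (-1)^h = 1 := fun h => by rw [← mul_pow]; simp
  cases h with
  | zero =>
    simp [gg, ch, dd_add, dd_one, dd_tt]; ring
  | succ h =>
    unfold gg
    rw [dd_smul, dd_add, dd_smul, dd_pow, dd_pow]
    simp only [Algebra.smul_def, ch, map_mul, map_pow, map_neg, map_one, map_add, map_natCast, Nat.add_sub_cancel]
    push_cast
    simp only [map_add, map_natCast, map_one, map_ofNat, pow_succ]
    have := e2 h
    generalize algebraMap ℚ ℚ⟦X⟧ (ch h) = K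
    generalize ((-1 : ℚ⟦X⟧))^h = e at *
    have e3 : e^2 = 1 := by rw [sq]; exact this
    have e4 : e^3 = e := by rw [pow_succ, e3, one_mul]
    have e5 : e^4 = 1 := by rw [pow_succ, e4]; exact this
    ring_nf
    simp only [e3, e4, e5]
    ring

lemma TT_eq (m) : ∀ h, (TT m h : ℚ) = ev m (gg h) := by
  induction m with
  | zero =>
    intro h
    simp only [TT, ev_zero, gg]
    cases h with
    | zero => simp [ch, cs_tt]
    | succ h => simp [cs_tt]
  | succ m ih =>
    intro h
    rw [ev_succ, dd_gg, ev_sub, ev_add, ev_smul, ev_smul, ev_smul, ← ih, ← ih, ← ih, TT]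
    push_cast; ring

lemma TT_top (n) : (TT (n+1) 0 : ℚ) = ev (n+1) tt := by
  rw [TT_eq]; simp [gg, ch, ev_add, ev_one_succ]
end
end DSB

namespace DSB
open Finset

def PM (R C : Finset ℕ) (w : ℕ → ℕ → ℤ) : ℤ := ∑ e : R ≃ C, ∏ r : R, w r (e r)

lemma PM_symm (R C w) : PM R C w = PM C R (fun c r => w r c) := by
  unfold PM
  refine Fintype.sum_equiv (Equiv.symmEquiv _ _) _ _ (fun e => ?_)
  refine Fintype.prod_equiv e _ _ (fun r => ?_)
  simp

lemma PM_congr {R C w w'} (h : ∀ r ∈ R, ∀ c ∈ C, w r c = w' r c) : PM R C w = PM R C w' := by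
  unfold PM
  refine sum_congr rfl fun e _ => prod_congr rfl fun r _ => h _ r.2 _ (e r).2

/-- the type-level version -/
def PT {α β : Type} [Fintype α] [Fintype β] [DecidableEq α] [DecidableEq β]
    (w : α → β → ℤ) : ℤ := ∑ e : α ≃ β, ∏ r, w r (e r)

lemma PT_equiv {α β α' β' : Type} [Fintype α] [Fintype β] [DecidableEq α] [DecidableEq β]
    [Fintype α'] [Fintype β'] [DecidableEq α'] [DecidableEq β'] (f : α ≃ α') (g : β ≃ β')
    (w : α → β → ℤ) (w' : α' → β' → ℤ) (h : ∀ a b, w a b = w' (f a) (g b)) : PT w = PT w' := by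
  unfold PT
  refine Fintype.sum_equiv (Equiv.equivCongr f g) _ _ (fun e => ?_)
  refine Fintype.prod_equiv f _ _ (fun r => ?_)
  simp [h]

lemma PT_option {α β : Type} [Fintype α] [Fintype β] [DecidableEq α] [DecidableEq β]
    (w : Option α → β → ℤ) :
    PT w = ∑ b, w none b * PT (fun (a : α) (c : {c // c ≠ b}) => w (some a) c) := by
  unfold PT
  rw [← Finset.sum_fiberwise (s := univ) (g := fun e : Option α ≃ β => e none)]
  refine sum_congr rfl fun b _ => ?_
  rw [mul_sum, ← Finset.sum_subtype_eq_sum_filter]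
  rw [Finset.subtype_univ]
  refine Fintype.sum_equiv (Equiv.optionSubtype b) _ _ (fun e => ?_)
  rw [Fintype.prod_option, e.2]
  rfl

lemma PM_row {r : ℕ} {R : Finset ℕ} (hr : r ∉ R) (C w) :
    PM (insert r R) C w = ∑ c ∈ C, w r c * PM R (C.erase c) w := by
  change PT (fun (a : (insert r R : Finset ℕ)) (b : C) => w a b) = _
  rw [PT_equiv (Finset.subtypeInsertEquivOption hr) (Equiv.refl _) _
    (fun (a : Option R) (b : C) => w (a.elim r (fun x => (x : ℕ))) b)]
  · rw [PT_option, ← Finset.sum_coe_sort C]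
    refine sum_congr rfl fun c _ => ?_
    congr 1
    let g : {x : C // x ≠ c} ≃ (C.erase c.1 : Finset ℕ) :=
      ⟨fun x => ⟨x.1.1, Finset.mem_erase.2 ⟨fun h => x.2 (Subtype.ext h), x.1.2⟩⟩,
       fun x => ⟨⟨x.1, (Finset.mem_erase.1 x.2).2⟩, fun h => (Finset.mem_erase.1 x.2).1 (congrArg Subtype.val h)⟩,
       fun x => rfl, fun x => rfl⟩
    exact PT_equiv (Equiv.refl R) g (fun (a : R) (b : {x : C // x ≠ c}) => w a b.1)
      (fun (a : R) (b : (C.erase c.1 : Finset ℕ)) => w a b) (fun a b => rfl)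
  · rintro ⟨a, ha⟩ b
    by_cases h : a = r
    · subst h; simp [Finset.subtypeInsertEquivOption]
    · simp [Finset.subtypeInsertEquivOption, h]

lemma PM_col {c : ℕ} {C : Finset ℕ} (hc : c ∉ C) (R w) :
    PM R (insert c C) w = ∑ r ∈ R, w r c * PM (R.erase r) C w := by
  rw [PM_symm, PM_row hc]
  refine sum_congr rfl fun r _ => ?_
  rw [PM_symm]

def WW (p q r c : ℕ) : ℤ :=
  if r < p then (if c < q then 0 else (-1)^c)
  else if c < q then 1 else if r < c then (-1)^(r+c) else 1

lemma sum_split (C I : Finset ℕ) (i : ℕ) (hC : ∀ c ∈ C, c < i) (hI : ∀ c ∈ I, i ≤ c) (f : ℕ → ℤ) :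
    ∑ c ∈ C ∪ I, (if c < i then f c else 0) = ∑ c ∈ C, f c := by
  rw [← sum_filter]
  congr 1
  ext x
  simp only [mem_filter, mem_union]
  constructor
  · rintro ⟨h | h, h'⟩
    · exact h
    · exact absurd (hI _ h) (by omega)
  · intro h; exact ⟨Or.inl h, hC _ h⟩

lemma neg_one_sq_pow (i : ℕ) : ((-1 : ℤ))^i * (-1)^i = 1 := by
  rw [← mul_pow]; simp

lemma half_row (i : ℕ) (R C I : Finset ℕ) (hR : i ∉ R) (hC : ∀ c ∈ C, c < i) (hI : ∀ c ∈ I, i ≤ c) :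
    PM (insert i R) (C ∪ I) (WW i i) = (-1)^i * PM (insert i R) (C ∪ I) (WW (i+1) i)
      + ∑ c ∈ C, PM R (C.erase c ∪ I) (WW (i+1) i) := by
  have h1 : ∀ c ∈ C ∪ I, PM R ((C ∪ I).erase c) (WW i i) = PM R ((C ∪ I).erase c) (WW (i+1) i) := by
    intro c _
    refine PM_congr fun r hr d _ => ?_
    have : r ≠ i := fun h => hR (h ▸ hr)
    have h2 : r < i ↔ r < i + 1 := by omega
    simp only [WW, h2]
  rw [PM_row hR, PM_row hR, mul_sum]
  have h3 : ∑ c ∈ C, PM R (C.erase c ∪ I) (WW (i+1) i) = ∑ c ∈ C, PM R ((C ∪ I).erase c) (WW (i+1) i) := by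
    refine sum_congr rfl fun c hc => ?_
    congr 1
    ext x
    have := hC c hc
    have := hI x
    simp only [mem_union, mem_erase]
    constructor
    · rintro (⟨h, h'⟩ | h)
      · exact ⟨h, Or.inl h'⟩
      · exact ⟨by have := hI x h; omega, Or.inr h⟩
    · rintro ⟨h, h' | h'⟩
      · exact Or.inl ⟨h, h'⟩
      · exact Or.inr h'
  rw [h3, ← sum_split C I i hC hI, ← sum_add_distrib]
  refine sum_congr rfl fun c hc => ?_
  rw [h1 c hc]
  have e := neg_one_sq_pow i
  have key : WW i i i c = (-1)^i * WW (i+1) i i c + (if c < i then 1 else 0) := by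
    unfold WW
    by_cases hci : c < i
    · simp [hci]
    · by_cases hic : i < c
      · simp [hci, hic, pow_add]
      · have : c = i := by omega
        subst this; simp [e]
  rw [key]
  split_ifs <;> ring

lemma half_col (i : ℕ) (R C I : Finset ℕ) (hC : i ∉ C) (hR : ∀ c ∈ R, c < i + 1) (hI : ∀ c ∈ I, i + 1 ≤ c) :
    PM (R ∪ I) (insert i C) (WW (i+1) i) = PM (R ∪ I) (insert i C) (WW (i+1) (i+1))
      + (-1)^i * ∑ r ∈ R, PM (R.erase r ∪ I) C (WW (i+1) (i+1)) := by
  have h1 : ∀ c ∈ R ∪ I, PM ((R ∪ I).erase c) C (WW (i+1) i) = PM ((R ∪ I).erase c) C (WW (i+1) (i+1)) := by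
    intro c _
    refine PM_congr fun r _ d hd => ?_
    have : d ≠ i := fun h => hC (h ▸ hd)
    have h2 : d < i ↔ d < i + 1 := by omega
    simp only [WW, h2]
  rw [PM_col hC, PM_col hC, mul_sum]
  have h3 : ∑ c ∈ R, (-1)^i * PM (R.erase c ∪ I) C (WW (i+1) (i+1)) =
      ∑ c ∈ R, (-1)^i * PM ((R ∪ I).erase c) C (WW (i+1) (i+1)) := by
    refine sum_congr rfl fun c hc => ?_
    congr 2
    ext x
    have := hR c hc
    simp only [mem_union, mem_erase]
    constructor
    · rintro (⟨h, h'⟩ | h)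
      · exact ⟨h, Or.inl h'⟩
      · exact ⟨by have := hI x h; omega, Or.inr h⟩
    · rintro ⟨h, h' | h'⟩
      · exact Or.inl ⟨h, h'⟩
      · exact Or.inr h'
  rw [h3, ← sum_split R I (i+1) hR hI, ← sum_add_distrib]
  refine sum_congr rfl fun r hr => ?_
  rw [h1 r hr]
  have key : WW (i+1) i r i = WW (i+1) (i+1) r i + (if r < i + 1 then (-1)^i else 0) := by
    unfold WW
    by_cases hci : r < i + 1
    · simp [hci]
    · have : ¬ r < i := by omega
      simp [hci, this]
  rw [key]
  split_ifs <;> ring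

lemma PM_main (m : ℕ) : ∀ (i h : ℕ) (R C : Finset ℕ), (∀ r ∈ R, r < i) → (∀ c ∈ C, c < i) →
    R.card = h → C.card = h →
    PM (R ∪ Ico i (i+m)) (C ∪ Ico i (i+m)) (WW i i) = (-1)^(i*h) * TT m h := by
  induction m with
  | zero =>
    intro i h R C hR hC cR cC
    simp only [add_zero, Ico_self, union_empty, TT]
    by_cases h0 : h = 0
    · subst h0
      obtain rfl := card_eq_zero.1 cR
      obtain rfl := card_eq_zero.1 cC
      simp [PM]
    · obtain ⟨r, hr⟩ := card_pos.1 (by omega : 0 < R.card)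
      rw [← insert_erase hr, PM_row (notMem_erase r R), if_neg h0, mul_zero]
      refine sum_eq_zero fun c hc => ?_
      simp [WW, hR r hr, hC c hc]
  | succ m ih =>
    intro i h R C hR hC cR cC
    have hI : Ico i (i+(m+1)) = insert i (Ico (i+1) (i+1+m)) := by
      ext x; simp only [mem_Ico, mem_insert]; omega
    have hI1 : ∀ c ∈ insert i (Ico (i+1) (i+1+m)), i ≤ c := by
      intro c hc; simp only [mem_Ico, mem_insert] at hc; omega
    have hI2 : ∀ c ∈ Ico (i+1) (i+1+m), i + 1 ≤ c := by
      intro c hc; simp only [mem_Ico] at hc; omega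
    set I := Ico (i+1) (i+1+m) with hIdef
    have iI : i ∉ I := fun hh => by have := hI2 i hh; omega
    have iR : i ∉ R := fun hh => by have := hR i hh; omega
    have iC : i ∉ C := fun hh => by have := hC i hh; omega
    have col : ∀ (R' C' : Finset ℕ) (k : ℕ), (∀ r ∈ R', r < i + 1) → (∀ c ∈ C', c < i) →
        R'.card = k + 1 → C'.card = k →
        PM (R' ∪ I) (C' ∪ insert i I) (WW (i+1) i) = (-1)^((i+1)*(k+1)) * TT m (k+1)
          + (-1)^i * ((k+1) * ((-1)^((i+1)*k) * TT m k)) := by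
      intro R' C' k hR' hC' cR' cC'
      have iC' : i ∉ C' := fun hh => by have := hC' i hh; omega
      rw [union_insert, half_col i R' (C' ∪ I) I (by simp [iC', iI]) hR' hI2]
      congr 1
      · rw [← insert_union]
        refine ih (i+1) (k+1) _ _ hR' ?_ cR' (by rw [card_insert_of_notMem iC', cC'])
        intro c hc
        rcases mem_insert.1 hc with rfl | hc
        · omega
        · have := hC' c hc; omega
      · rw [sum_congr rfl (fun r hr => ih (i+1) k (R'.erase r) C'
          (fun x hx => hR' x (mem_of_mem_erase hx)) (fun x hx => by have := hC' x hx; omega)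
          (by rw [card_erase_of_mem hr, cR']; rfl) cC'), sum_const, cR']
        simp
    rw [hI, union_insert, half_row i (R ∪ I) C (insert i I) (by simp [iR, iI]) hC hI1,
      ← insert_union, col (insert i R) C h ?_ hC (by rw [card_insert_of_notMem iR, cR]) cC]
    · have hs : ∑ c ∈ C, PM (R ∪ I) (C.erase c ∪ insert i I) (WW (i+1) i)
          = h * ((-1)^((i+1)*h) * TT m h + (-1)^i * (h * ((-1)^((i+1)*(h-1)) * TT m (h-1)))) := by
        cases h with
        | zero =>
          obtain rfl := card_eq_zero.1 cC
          simp
        | succ k =>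
          rw [sum_congr rfl (fun c hc => col R (C.erase c) k
            (fun x hx => by have := hR x hx; omega) (fun x hx => hC x (mem_of_mem_erase hx)) cR
            (by rw [card_erase_of_mem hc, cC]; rfl)), sum_const, cC]
          simp
      rw [hs, TT]
      have e1 := neg_one_sq_pow i
      have e2 := neg_one_sq_pow h
      cases h with
      | zero =>
        simp [pow_succ]
        ring_nf
        simp [← mul_assoc, e1]
        try ring
      | succ k =>
        have e3 := neg_one_sq_pow k
        have e4 := neg_one_sq_pow (i * k)
        simp only [Nat.add_sub_cancel, add_mul, mul_add, pow_add, mul_one, one_mul, pow_one]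
        generalize TT m (k+1+1) = A
        generalize TT m (k+1) = B
        generalize TT m k = D
        generalize (-1 : ℤ)^i = x at *
        generalize (-1 : ℤ)^k = y at *
        generalize (-1 : ℤ)^(i*k) = z at *
        have e1' : x^2 = 1 := by rw [sq]; exact e1
        have e1'' : x^3 = x := by rw [pow_succ, e1', one_mul]
        push_cast
        ring_nf
        simp only [e1', e1'']
        ring
    · intro c hc
      rcases mem_insert.1 hc with rfl | hc
      · omega
      · have := hR c hc; omega

lemma sum_eq_TT (n : ℕ) : ∑ σ : Equiv.Perm (Fin n), ((-1 : ℤ)) ^ depthN σ = TT n 0 := by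
  have h := PM_main n 0 0 ∅ ∅ (by simp) (by simp) rfl rfl
  simp only [empty_union, zero_add, zero_mul, pow_zero, one_mul] at h
  rw [← h]
  let g : Fin n ≃ (Ico 0 n : Finset ℕ) :=
    ⟨fun x => ⟨x.1, by simp⟩, fun x => ⟨x.1, by simpa using x.2⟩, fun x => rfl, fun x => rfl⟩
  have h2 := PT_equiv g g (fun a b => WW 0 0 a b) (fun a b => WW 0 0 a b) (fun a b => rfl)
  refine Eq.trans ?_ h2
  unfold PT
  refine sum_congr rfl fun σ _ => ?_
  rw [depthN, ← prod_pow_eq_pow_sum, prod_filter]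
  refine prod_congr rfl fun i _ => ?_
  simp only [WW, Nat.not_lt_zero, if_false, Fin.lt_def]
  split_ifs with hlt
  · obtain ⟨k, hk⟩ := Nat.exists_eq_add_of_lt hlt
    rw [hk, show (i:ℕ) + k + 1 - i = k + 1 by omega, show (i:ℕ) + (i + k + 1) = (i + i) + (k+1) by omega,
      pow_add _ ((i:ℕ)+i), Even.neg_one_pow ⟨_, rfl⟩, one_mul]
  · rfl
end DSB

namespace DSB
open Finset

def mkP {n : ℕ} (k : Fin (n+1)) (τ : Equiv.Perm (Fin n)) : Equiv.Perm (Fin (n+1)) :=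
  (finSuccEquiv' 0).trans ((Equiv.optionCongr τ).trans (finSuccEquiv' k).symm)

lemma mkP_zero {n : ℕ} (k : Fin (n+1)) (τ : Equiv.Perm (Fin n)) : mkP k τ 0 = k := by
  simp [mkP]

lemma mkP_succ {n : ℕ} (k : Fin (n+1)) (τ : Equiv.Perm (Fin n)) (i : Fin n) :
    mkP k τ i.succ = k.succAbove (τ i) := by
  have : finSuccEquiv' (0 : Fin (n+1)) i.succ = some i := by
    rw [← Fin.succAbove_zero, finSuccEquiv'_succAbove]
  simp [mkP, this]

lemma mkP_bij (n : ℕ) : Function.Bijective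
    (fun p : Fin (n+1) × Equiv.Perm (Fin n) => mkP p.1 p.2) := by
  rw [Fintype.bijective_iff_injective_and_card]
  constructor
  · rintro ⟨k, τ⟩ ⟨k', τ'⟩ h
    have h0 := congrArg (fun σ : Equiv.Perm (Fin (n+1)) => σ 0) h
    simp only [mkP_zero] at h0
    subst h0
    congr 1
    ext1 i
    have h1 := congrArg (fun σ : Equiv.Perm (Fin (n+1)) => σ i.succ) h
    simp only [mkP_succ] at h1
    exact Fin.succAbove_right_injective h1
  · simp [Fintype.card_perm, Nat.factorial_succ]

def cmpl {n : ℕ} (τ : Equiv.Perm (Fin n)) : Equiv.Perm (Fin n) := τ.trans Fin.revPerm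

lemma cmpl_apply {n : ℕ} (τ : Equiv.Perm (Fin n)) (i) : cmpl τ i = (τ i).rev := rfl

lemma alt_mkP {n : ℕ} (k : Fin (n+2)) (τ : Equiv.Perm (Fin (n+1))) :
    IsAlternating (mkP k τ) ↔ ((τ 0 : ℕ) < k ∧ IsAlternating (cmpl τ)) := by
  have h0 : mkP k τ ⟨0 + 1, by omega⟩ < mkP k τ ⟨0, by omega⟩ ↔ (τ 0 : ℕ) < k := by
    have e1 : mkP k τ ⟨0 + 1, by omega⟩ = k.succAbove (τ 0) := mkP_succ k τ 0
    have e2 : mkP k τ ⟨0, by omega⟩ = k := mkP_zero k τ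
    rw [e1, e2, Fin.succAbove_lt_iff_castSucc_lt]
    rfl
  have hs : ∀ i (h : i + 1 < n + 2), mkP k τ ⟨i + 1, h⟩ = k.succAbove (τ ⟨i, by omega⟩) :=
    fun i h => mkP_succ k τ ⟨i, by omega⟩
  constructor
  · intro H
    refine ⟨h0.1 (by simpa using H 0 (by omega)), ?_⟩
    intro i hi
    have := H (i+1) (by omega)
    rw [hs (i+1) (by omega), hs i (by omega)] at this
    simp only [Nat.even_add_one, Fin.succAbove_lt_succAbove_iff] at this
    simp only [cmpl_apply, Fin.rev_lt_rev]
    split_ifs at this ⊢ <;> first | assumption | (exfalso; tauto)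
  · rintro ⟨h1, H⟩ i hi
    cases i with
    | zero => simpa using h0.2 h1
    | succ i =>
      have := H i (by omega)
      rw [hs (i+1) (by omega), hs i (by omega)]
      simp only [Nat.even_add_one, Fin.succAbove_lt_succAbove_iff]
      simp only [cmpl_apply, Fin.rev_lt_rev] at this
      split_ifs at this ⊢ <;> first | assumption | (exfalso; tauto)

open Classical in
noncomputable def DD (n k : ℕ) : ℕ :=
  (univ.filter fun σ : Equiv.Perm (Fin (n+1)) => IsAlternating σ ∧ (σ 0 : ℕ) = k).card

open Classical in
lemma DD_eq (n k : ℕ) (hk : k ≤ n + 1) : DD (n+1) k =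
    (univ.filter fun σ : Equiv.Perm (Fin (n+1)) => IsAlternating σ ∧ n - (σ 0 : ℕ) < k).card := by
  unfold DD
  symm
  refine card_bij (fun σ _ => mkP ⟨k, by omega⟩ (cmpl σ)) ?_ ?_ ?_
  · intro σ hσ
    simp only [mem_filter, mem_univ, true_and] at hσ ⊢
    rw [alt_mkP, mkP_zero]
    refine ⟨⟨?_, ?_⟩, rfl⟩
    · rw [cmpl_apply, Fin.val_rev]
      have := hσ.2
      simp only
      omega
    · have : cmpl (cmpl σ) = σ := by ext i; simp [cmpl_apply]
      rw [this]; exact hσ.1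
  · intro σ _ σ' _ h
    have h1 := (mkP_bij (n+1)).1 (a₁ := (_, _)) (a₂ := (_, _)) h
    have h2 : cmpl σ = cmpl σ' := (Prod.ext_iff.1 h1).2
    ext i
    have := congrArg (fun s : Equiv.Perm (Fin (n+1)) => s i) h2
    simp only [cmpl_apply] at this
    rw [Fin.rev_injective this]
  · intro σ hσ
    simp only [mem_filter, mem_univ, true_and] at hσ
    obtain ⟨⟨k', τ⟩, rfl⟩ := (mkP_bij (n+1)).2 σ
    simp only [alt_mkP, mkP_zero] at hσ
    obtain ⟨⟨h1, h2⟩, h3⟩ := hσ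
    subst h3
    refine ⟨cmpl τ, ?_, ?_⟩
    · simp only [mem_filter, mem_univ, true_and]
      refine ⟨h2, ?_⟩
      rw [cmpl_apply, Fin.val_rev]
      have := (τ 0).2
      omega
    · have : cmpl (cmpl τ) = τ := by ext i; simp [cmpl_apply]
      simp [this]

lemma DD_zero (n : ℕ) : DD (n+1) 0 = 0 := by
  rw [DD_eq _ _ (by omega)]; simp

lemma DD_zero_zero : DD 0 0 = 1 := by
  classical
  unfold DD
  rw [filter_true_of_mem]
  · simp [Fintype.card_perm]
  · intro σ _
    exact ⟨fun i h => absurd h (by omega), by omega⟩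

lemma DD_succ (n k : ℕ) (hk : k ≤ n) : DD (n+1) (k+1) = DD (n+1) k + DD n (n-k) := by
  classical
  rw [DD_eq _ _ (by omega), DD_eq _ _ (by omega), DD, ← card_union_of_disjoint]
  · congr 1
    ext σ
    have := (σ 0).2
    simp only [mem_filter, mem_univ, true_and, mem_union, ← and_or_left]
    refine and_congr_right fun _ => ?_
    omega
  · rw [disjoint_left]
    intro σ h1 h2
    have := (σ 0).2
    simp only [mem_filter, mem_univ, true_and] at h1 h2
    omega

lemma eulerE_eq (n : ℕ) : eulerE (n+1) = DD (n+1) (n+1) := by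
  classical
  rw [DD_eq _ _ le_rfl, eulerE, Nat.card_eq_fintype_card, Fintype.card_subtype]
  congr 1
  ext σ
  simp only [mem_filter, mem_univ, true_and]
  exact ⟨fun h => ⟨h, by omega⟩, fun h => h.1⟩
end DSB

namespace DSB
lemma DD_aa (N : ℕ) : ∀ k ≤ N, (DD N k : ℚ) = aa (N-k) k := by
  induction N with
  | zero =>
    intro k hk
    obtain rfl : k = 0 := by omega
    simp [DD_zero_zero, aa_zero]
  | succ N ih =>
    intro k
    induction k with
    | zero => intro _; simp [DD_zero, aa_zero]
    | succ k ihk =>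
      intro hk
      rw [DD_succ N k (by omega), aa_succ]
      push_cast
      rw [ihk (by omega), ih (N-k) (by omega)]
      congr 2 <;> omega

lemma eulerE_odd (n : ℕ) (h : Odd (n+1)) : (eulerE (n+1) : ℚ) = ev (n+1) tt := by
  rw [eulerE_eq, DD_aa _ _ le_rfl, Nat.sub_self, aa_top, ev_se_odd _ h, zero_add]
end DSB

/-- Sign-balance of depth: `0` for even `n`, the Euler number `E_n` for odd `n`. -/
theorem depth_sign_balance (n : ℕ) (hn : 1 ≤ n) :
    (Even n → ∑ σ : Equiv.Perm (Fin n), ((-1 : ℤ)) ^ depthN σ = 0) ∧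
    (Odd n → ∑ σ : Equiv.Perm (Fin n), ((-1 : ℤ)) ^ depthN σ = eulerE n) := by
  obtain ⟨m, rfl⟩ : ∃ m, n = m + 1 := ⟨n - 1, by omega⟩
  rw [DSB.sum_eq_TT]
  constructor
  · intro h
    have h1 := DSB.TT_top m
    rw [DSB.ev_tt_even _ h] at h1
    exact_mod_cast h1
  · intro h
    have h1 := DSB.TT_top m
    rw [← DSB.eulerE_odd m h] at h1
    exact_mod_cast h1
end

section
/- The number of permutations of 𝔖_n with even depth minus the number with odd depth equals the number of alternating permutations of 𝔖_n when n is odd. -/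
section
open Finset

def wt (y : ℤ) {α : Type*} [LinearOrder α] (i j : α) : ℤ :=
  if j = i then y else if j < i then -1 else 1

def PP (α : Type*) [LinearOrder α] [Fintype α] (y : ℤ) : ℤ :=
  ∑ σ : Equiv.Perm α, ∏ i, wt y i (σ i)

lemma PP_congr {α β : Type*} [LinearOrder α] [Fintype α] [LinearOrder β] [Fintype β]
    (e : α ≃o β) (y : ℤ) : PP α y = PP β y := by
  unfold PP
  refine Fintype.sum_equiv (Equiv.permCongr e.toEquiv) _ _ fun σ => ?_
  refine Fintype.prod_equiv e.toEquiv _ _ fun i => ?_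
  simp [wt]

lemma PP_sub {α : Type*} [LinearOrder α] [Fintype α] (s : Finset α) (y : ℤ) :
    ∑ σ : Equiv.Perm α, (if ∀ i, ¬ i ∈ s → σ i = i then ∏ i ∈ s, wt y i (σ i) else 0)
      = PP s y := by
  unfold PP
  rw [← Finset.sum_filter]
  symm
  rw [← Finset.sum_coe_sort (Finset.univ.filter _)]
  let e := (Equiv.Perm.subtypeEquivSubtypePerm (fun i => i ∈ s))
  let e2 : {f : Equiv.Perm α // ∀ a, ¬ a ∈ s → f a = a} ≃
    (Finset.univ.filter fun σ : Equiv.Perm α => ∀ i, ¬ i ∈ s → σ i = i) :=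
    Equiv.subtypeEquivRight (by simp)
  refine Fintype.sum_equiv (e.trans e2) _ _ fun σ => ?_
  rw [← Finset.prod_coe_sort s]
  refine Finset.prod_congr rfl fun i _ => ?_
  have : ((e.trans e2) σ : Equiv.Perm α) i = (σ i : α) := by
    simp [e, e2, Equiv.Perm.subtypeEquivSubtypePerm]
  rw [this]
  simp only [wt, ← Subtype.coe_inj, ← Subtype.coe_lt_coe]

lemma PP_add (n : ℕ) (y x : ℤ) :
    PP (Fin n) (y + x) = ∑ k ∈ range (n+1), (n.choose k) * PP (Fin k) y * x ^ (n - k) := by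
  have h1 : ∀ σ : Equiv.Perm (Fin n), ∏ i, wt (y + x) i (σ i) =
      ∑ s : Finset (Fin n), (if ∀ i, ¬ i ∈ s → σ i = i then ∏ i ∈ s, wt y i (σ i) else 0)
        * x ^ (n - s.card) := by
    intro σ
    have : ∀ i, wt (y + x) i (σ i) = wt y i (σ i) + (if σ i = i then x else 0) := by
      intro i; unfold wt; split_ifs <;> simp
    simp_rw [this]
    rw [Finset.prod_add, Finset.powerset_univ]
    refine Finset.sum_congr rfl fun s _ => ?_
    rw [Finset.prod_ite_zero]
    have hc : (univ \ s).card = n - s.card := by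
      rw [Finset.card_sdiff_of_subset (subset_univ _)]; simp
    simp only [mem_sdiff, mem_univ, true_and, prod_const, hc]
    split_ifs <;> simp
  unfold PP
  simp_rw [h1]
  rw [Finset.sum_comm]
  have h3 : ∀ s : Finset (Fin n), ∑ σ : Equiv.Perm (Fin n),
      (if ∀ i, ¬ i ∈ s → σ i = i then ∏ i ∈ s, wt y i (σ i) else 0) = PP s y := by
    intro s
    rw [← PP_sub s y]
    refine Finset.sum_congr rfl fun σ _ => ?_
    congr
  simp_rw [← Finset.sum_mul, h3]
  have h2 : ∀ s : Finset (Fin n), PP s y = PP (Fin s.card) y := fun s =>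
    (PP_congr (s.orderIsoOfFin rfl) y).symm
  simp_rw [h2]
  rw [← Finset.powerset_univ, Finset.sum_powerset_apply_card
    (fun k => PP (Fin k) y * x ^ (n - k))]
  simp [PP, mul_assoc]

lemma PP_neg (n : ℕ) : PP (Fin (n+1)) (-1) = - PP (Fin (n+1)) 1 := by
  unfold PP
  rw [← Finset.sum_neg_distrib]
  refine Fintype.sum_equiv (Equiv.mulRight (finRotate (n+1))⁻¹) _ _ fun σ => ?_
  have h : ∏ i, wt 1 i ((Equiv.mulRight (finRotate (n+1))⁻¹ σ) i)
      = ∏ i, wt 1 (finRotate (n+1) i) (σ i) := by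
    symm
    refine Fintype.prod_equiv (finRotate (n+1)) _ _ fun i => ?_
    simp
  rw [h, Fin.prod_univ_castSucc, Fin.prod_univ_castSucc]
  have h1 : ∀ i : Fin n, wt (-1) i.castSucc (σ i.castSucc)
      = wt 1 (finRotate (n+1) i.castSucc) (σ i.castSucc) := by
    intro i
    have : finRotate (n+1) i.castSucc = i.succ := by simp
    rw [this]
    generalize σ i.castSucc = j
    unfold wt
    simp only [Fin.ext_iff, Fin.lt_def, Fin.val_succ, Fin.val_castSucc]
    split_ifs <;> omega
  have h2 : wt (-1) (Fin.last n) (σ (Fin.last n)) = -1 := by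
    generalize σ (Fin.last n) = j
    unfold wt
    have := j.2
    simp only [Fin.ext_iff, Fin.lt_def, Fin.val_last]
    split_ifs <;> omega
  have h3 : wt 1 (finRotate (n+1) (Fin.last n)) (σ (Fin.last n)) = 1 := by
    generalize σ (Fin.last n) = j
    unfold wt
    simp
  simp_rw [h1, h2, h3]
  simp

lemma PP_zero (y : ℤ) : PP (Fin 0) y = 1 := by simp [PP]

lemma PP_rec (n : ℕ) :
    ∑ k ∈ range (n+1), (n.choose k) * PP (Fin k) 1 * (1 + (-1) ^ (n - k)) = (2:ℤ) := by
  have e1 := PP_add n 1 1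
  have e2 := PP_add n 1 (-1)
  have e3 := PP_add n (-1) 1
  have e4 : PP (Fin n) (1+1) + PP (Fin n) (-1+1) = 2 := by
    rw [e1, e3, ← Finset.sum_add_distrib, Finset.sum_range_succ']
    have : ∀ k, PP (Fin (k+1)) (-1) = - PP (Fin (k+1)) 1 := PP_neg
    simp [this, PP_zero]
  have e5 : PP (Fin n) (-1+1) = PP (Fin n) (1 + -1) := by norm_num
  rw [e5, e1, e2, ← Finset.sum_add_distrib] at e4
  rw [← e4]
  refine Finset.sum_congr rfl fun k _ => ?_
  simp; ring

def rhoF (m : ℕ) (i : Fin (2*m+1)) : Fin (2*m+1) :=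
  ⟨if i.1 % 2 = 0 then i.1 / 2 else 2 * m - i.1 / 2, by have := i.2; split_ifs <;> omega⟩

lemma rhoF_inj (m : ℕ) : Function.Injective (rhoF m) := by
  intro i j h
  have h1 := i.2
  have h2 := j.2
  simp only [rhoF, Fin.mk.injEq] at h
  ext
  split_ifs at h <;> omega

noncomputable def rhoE (m : ℕ) : Equiv.Perm (Fin (2*m+1)) :=
  Equiv.ofBijective (rhoF m) (Finite.injective_iff_bijective.1 (rhoF_inj m))

lemma wt_key (m : ℕ) (i j : Fin (2*m+1)) :
    (if i < j then (-1 : ℤ) ^ (j.1 - i.1) else 1) =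
      wt 1 (rhoE m i) (Fin.revPerm (rhoE m j)) * (-1) ^ j.1 := by
  have hi := i.2
  have hj := j.2
  have e1 : rhoE m i = rhoF m i := rfl
  have e2 : rhoE m j = rhoF m j := rfl
  rw [e1, e2]
  simp only [wt, Fin.revPerm_apply, Fin.ext_iff, Fin.lt_def, Fin.val_rev, rhoF]
  rcases Nat.even_or_odd' i.1 with ⟨p, hp | hp⟩ <;>
  rcases Nat.even_or_odd' j.1 with ⟨q, hq | hq⟩
  · have : (-1:ℤ)^(j.1 - i.1) = 1 := Even.neg_one_pow ⟨q - p, by omega⟩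
    have h2 : (-1:ℤ)^(j.1) = 1 := Even.neg_one_pow ⟨q, by omega⟩
    rw [this, h2]
    split_ifs <;> first | rfl | omega
  · have h2 : (-1:ℤ)^(j.1) = -1 := Odd.neg_one_pow ⟨q, by omega⟩
    rw [h2]
    by_cases h : i.1 < j.1
    · have : (-1:ℤ)^(j.1 - i.1) = -1 := Odd.neg_one_pow ⟨q - p, by omega⟩
      rw [this]
      split_ifs <;> first | rfl | omega
    · split_ifs <;> first | rfl | omega
  · have h2 : (-1:ℤ)^(j.1) = 1 := Even.neg_one_pow ⟨q, by omega⟩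
    rw [h2]
    by_cases h : i.1 < j.1
    · have : (-1:ℤ)^(j.1 - i.1) = -1 := Odd.neg_one_pow ⟨q - p - 1, by omega⟩
      rw [this]
      split_ifs <;> first | rfl | omega
    · split_ifs <;> first | rfl | omega
  · have : (-1:ℤ)^(j.1 - i.1) = 1 := Even.neg_one_pow ⟨q - p, by omega⟩
    have h2 : (-1:ℤ)^(j.1) = -1 := Odd.neg_one_pow ⟨q, by omega⟩
    rw [this, h2]
    split_ifs <;> first | rfl | omega

lemma prod_sign (m : ℕ) : ∏ j : Fin (2*m+1), (-1 : ℤ) ^ j.1 = (-1) ^ m := by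
  rw [Fin.prod_univ_eq_prod_range (fun j => (-1:ℤ)^j)]
  induction m with
  | zero => simp
  | succ m ih =>
    rw [show 2*(m+1)+1 = 2*m+1+1+1 by ring, Finset.prod_range_succ, Finset.prod_range_succ, ih]
    rw [show 2*m+1+1 = 2*(m+1) by ring]
    rw [pow_succ, pow_mul, pow_mul]; simp [pow_succ]

lemma depth_sum (m : ℕ) :
    ∑ σ : Equiv.Perm (Fin (2*m+1)), (-1 : ℤ) ^ depthN σ = (-1) ^ m * PP (Fin (2*m+1)) 1 := by
  unfold PP
  rw [Finset.mul_sum]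
  refine Fintype.sum_equiv (Equiv.permCongr (rhoE m) |>.trans
    (Equiv.mulLeft Fin.revPerm)) _ _ fun σ => ?_
  have h1 : (-1 : ℤ) ^ depthN σ = ∏ i, (if i < σ i then (-1 : ℤ) ^ ((σ i).1 - i.1) else 1) := by
    rw [depthN, ← Finset.prod_pow_eq_pow_sum, Finset.prod_filter]
  rw [h1]
  simp_rw [wt_key]
  rw [Finset.prod_mul_distrib, mul_comm, Equiv.prod_comp σ (fun j => (-1:ℤ)^j.1), prod_sign]
  congr 1
  refine Fintype.prod_equiv (rhoE m) _ _ fun i => ?_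
  simp

lemma even_sub (n : ℕ) :
    ((Finset.univ.filter fun σ : Equiv.Perm (Fin n) => Even (depthN σ)).card : ℤ) -
      ((Finset.univ.filter fun σ : Equiv.Perm (Fin n) => ¬ Even (depthN σ)).card : ℤ) =
    ∑ σ : Equiv.Perm (Fin n), (-1 : ℤ) ^ depthN σ := by
  rw [Finset.card_filter, Finset.card_filter]
  push_cast
  rw [← Finset.sum_sub_distrib]
  refine Finset.sum_congr rfl fun σ _ => ?_
  by_cases h : Even (depthN σ)
  · simp [h, h.neg_one_pow]
  · simp [h, (Nat.not_even_iff_odd.1 h).neg_one_pow]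

def GP (k r : ℕ) (σ : Equiv.Perm (Fin (k+r))) : Prop :=
  (∀ i : ℕ, (h : i + 1 < k) →
    if Even i then σ (Fin.castAdd r ⟨i + 1, h⟩) < σ (Fin.castAdd r ⟨i, Nat.lt_of_succ_lt h⟩)
    else σ (Fin.castAdd r ⟨i, Nat.lt_of_succ_lt h⟩) < σ (Fin.castAdd r ⟨i + 1, h⟩)) ∧
  StrictMono (fun i : Fin r => σ (Fin.natAdd k i))

lemma perm_strictMono {n : ℕ} (σ : Equiv.Perm (Fin n)) (h : StrictMono σ) : σ = 1 := by
  have : (h.orderIsoOfSurjective σ σ.surjective) = OrderIso.refl _ := Subsingleton.elim _ _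
  ext i
  have := congrArg (fun f : Fin n ≃o Fin n => f i) this
  simpa using congrArg Fin.val this

open Classical in
noncomputable def EE (n : ℕ) : ℕ :=
  (Finset.univ.filter fun σ : Equiv.Perm (Fin n) => IsAlternating σ).card

open Classical in
lemma card_GP (k r : ℕ) :
    (Finset.univ.filter fun σ : Equiv.Perm (Fin (k+r)) => GP k r σ).card
      = (k+r).choose k * EE k := by
  have hmap : ∀ σ ∈ (Finset.univ.filter fun σ : Equiv.Perm (Fin (k+r)) => GP k r σ),
      (univ.image fun i : Fin k => σ (Fin.castAdd r i)) ∈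
        powersetCard k (univ : Finset (Fin (k+r))) := by
    intro σ _
    rw [mem_powersetCard]
    refine ⟨subset_univ _, ?_⟩
    rw [card_image_of_injective]
    · simp
    · exact σ.injective.comp (Fin.castAdd_injective k r)
  rw [Finset.card_eq_sum_card_fiberwise (t := powersetCard k (univ : Finset (Fin (k+r)))) hmap]
  rw [Finset.sum_const_nat (m := EE k)]
  · simp
  intro s hs
  rw [mem_powersetCard] at hs
  have hk : s.card = k := hs.2
  have hr : sᶜ.card = r := by rw [card_compl, hk]; simp
  let e := finSumEquivOfFinset hk hr
  let F : Equiv.Perm (Fin k) → Equiv.Perm (Fin (k+r)) := fun τ =>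
    finSumFinEquiv.symm.trans ((Equiv.Perm.sumCongr τ 1).trans e)
  have F1 : ∀ τ i, F τ (Fin.castAdd r i) = s.orderEmbOfFin hk (τ i) := by
    intro τ i; simp [F, e]
  have F2 : ∀ τ i, F τ (Fin.natAdd k i) = sᶜ.orderEmbOfFin hr i := by
    intro τ i; simp [F, e]
  symm
  unfold EE
  refine Finset.card_bij (fun τ _ => F τ) ?_ ?_ ?_
  · intro τ hτ
    simp only [mem_filter, mem_univ, true_and] at hτ ⊢
    refine ⟨⟨?_, ?_⟩, ?_⟩
    · intro i h
      simp only [F1, OrderEmbedding.lt_iff_lt]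
      exact hτ i h
    · simp only [F2]
      exact OrderEmbedding.strictMono _
    · simp only [F1]
      ext x
      simp only [mem_image, mem_univ, true_and]
      constructor
      · rintro ⟨i, rfl⟩
        exact orderEmbOfFin_mem s hk _
      · intro hx
        have : x ∈ Set.range (s.orderEmbOfFin hk) := by
          rw [range_orderEmbOfFin]; exact hx
        obtain ⟨i, rfl⟩ := this
        exact ⟨τ.symm i, by simp⟩
  · intro τ _ τ' _ h
    ext i
    have := congrArg (fun f => f (Fin.castAdd r i)) h
    simp only [F1] at this
    exact congrArg Fin.val ((s.orderEmbOfFin hk).injective this)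
  · intro σ hσ
    simp only [mem_filter, mem_univ, true_and] at hσ
    obtain ⟨⟨ha, hm⟩, him⟩ := hσ
    let σ' : Equiv.Perm (Fin k ⊕ Fin r) := (finSumFinEquiv.trans σ).trans e.symm
    have hr' : Set.MapsTo σ' (Set.range Sum.inl) (Set.range Sum.inl) := by
      rintro _ ⟨i, rfl⟩
      have : σ (Fin.castAdd r i) ∈ s := by
        rw [← him]; exact mem_image_of_mem _ (mem_univ i)
      have : σ (Fin.castAdd r i) ∈ Set.range (s.orderEmbOfFin hk) := by
        rw [range_orderEmbOfFin]; exact this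
      obtain ⟨j, hj⟩ := this
      refine ⟨j, ?_⟩
      simp only [σ', Equiv.trans_apply, finSumFinEquiv_apply_left]
      rw [Equiv.eq_symm_apply, ← hj]
      simp [e]
    obtain ⟨⟨τ, υ⟩, hτ⟩ := Equiv.Perm.mem_sumCongrHom_range_of_perm_mapsTo_inl hr'
    have hs' : ∀ x, σ (finSumFinEquiv x) = e (σ' x) := by intro x; simp [σ']
    rw [← hτ] at hs'
    have G1 : ∀ i, σ (Fin.castAdd r i) = s.orderEmbOfFin hk (τ i) := by
      intro i
      have := hs' (Sum.inl i)
      simpa [e] using this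
    have G2 : ∀ i, σ (Fin.natAdd k i) = sᶜ.orderEmbOfFin hr (υ i) := by
      intro i
      have := hs' (Sum.inr i)
      simpa [e] using this
    have hu : υ = 1 := by
      apply perm_strictMono
      intro i j hij
      have := hm hij
      simpa only [G2, OrderEmbedding.lt_iff_lt] using this
    subst hu
    refine ⟨τ, ?_, ?_⟩
    · simp only [mem_filter, mem_univ, true_and]
      intro i h
      have := ha i h
      simpa only [G1, OrderEmbedding.lt_iff_lt] using this
    · ext x
      refine Fin.addCases (fun i => ?_) (fun i => ?_) x
      · rw [F1, G1]
      · rw [F2, G2]; rfl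

def YP (n t : ℕ) (σ : Equiv.Perm (Fin n)) : Prop :=
  ∀ i : ℕ, (h : i + 1 < n) →
    if i < t ∧ Even i then σ ⟨i + 1, h⟩ < σ ⟨i, Nat.lt_of_succ_lt h⟩
    else σ ⟨i, Nat.lt_of_succ_lt h⟩ < σ ⟨i + 1, h⟩

open Classical in
noncomputable def YY (n t : ℕ) : ℕ :=
  (Finset.univ.filter fun σ : Equiv.Perm (Fin n) => YP n t σ).card

lemma strictMono_of_step {n : ℕ} {α : Type*} [Preorder α] (f : Fin n → α)
    (h : ∀ i (hi : i + 1 < n), f ⟨i, Nat.lt_of_succ_lt hi⟩ < f ⟨i + 1, hi⟩) : StrictMono f := by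
  cases n with
  | zero => intro i; exact i.elim0
  | succ n =>
    rw [Fin.strictMono_iff_lt_succ]
    intro i
    exact h i.1 (by omega)

lemma YY_zero (n : ℕ) : YY n 0 = 1 := by
  classical
  unfold YY
  rw [Finset.card_eq_one]
  refine ⟨1, ?_⟩
  ext σ
  simp only [mem_filter, mem_univ, true_and, mem_singleton]
  constructor
  · intro h
    apply perm_strictMono
    apply strictMono_of_step
    intro i hi
    simpa using h i hi
  · rintro rfl i hi
    simp

lemma YY_top (m : ℕ) : YY (2*m+1) (2*m) = EE (2*m+1) := by
  classical
  unfold YY EE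
  congr 1
  ext σ
  simp only [mem_filter, mem_univ, true_and]
  unfold YP IsAlternating
  refine forall_congr' fun i => forall_congr' fun h => ?_
  have : i < 2 * m := by omega
  simp [this]

lemma GP_iff (j r : ℕ) (σ : Equiv.Perm (Fin (2*j+1+(r+1)))) :
    GP (2*j+1) (r+1) σ ↔ ∀ i : ℕ, (h : i + 1 < 2*j+1+(r+1)) → i ≠ 2*j →
      if i < 2*j ∧ Even i then σ ⟨i + 1, h⟩ < σ ⟨i, Nat.lt_of_succ_lt h⟩
      else σ ⟨i, Nat.lt_of_succ_lt h⟩ < σ ⟨i + 1, h⟩ := by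
  constructor
  · rintro ⟨h1, h2⟩ i h hne
    rcases lt_or_gt_of_ne hne with hlt | hgt
    · simpa [hlt] using h1 i (by omega)
    · have : ¬ i < 2 * j := by omega
      simp only [this, false_and, if_false]
      have h3 := @h2 ⟨i - (2*j+1), by omega⟩ ⟨i - (2*j+1) + 1, by omega⟩
        (by simp [Fin.lt_def])
      simp only [Fin.natAdd_mk] at h3
      have q1 : 2*j+1+(i-(2*j+1)) = i := by omega
      have q2 : 2*j+1+(i-(2*j+1)+1) = i+1 := by omega
      simpa only [q1, q2] using h3
  · intro h
    refine ⟨fun i hi => ?_, ?_⟩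
    · have hlt : i < 2 * j := by omega
      simpa [hlt] using h i (by omega) (by omega)
    · apply strictMono_of_step
      intro i hi
      have h3 := h (2*j+1+i) (by omega) (by omega)
      have : ¬ 2*j+1+i < 2 * j := by omega
      simp only [this, false_and, if_false] at h3
      exact h3

lemma GP_split (j r : ℕ) (σ : Equiv.Perm (Fin (2*j+1+(r+1)))) :
    GP (2*j+1) (r+1) σ ↔ (YP _ (2*j) σ ∨ YP _ (2*(j+1)) σ) := by
  rw [GP_iff]
  constructor
  · intro h
    have hne : σ ⟨2*j, by omega⟩ ≠ σ ⟨2*j+1, by omega⟩ := by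
      intro h; have := σ.injective h; simp at this
    rcases lt_or_gt_of_ne hne with hlt | hgt
    · left
      intro i hi
      by_cases hij : i = 2 * j
      · subst hij; simpa using hlt
      · exact h i hi hij
    · right
      intro i hi
      by_cases hij : i = 2 * j
      · subst hij
        rw [if_pos ⟨by omega, by simp⟩]; exact hgt
      · have h3 := h i hi hij
        have : (i < 2 * (j+1) ∧ Even i) ↔ (i < 2 * j ∧ Even i) := by
          rw [Nat.even_iff]; omega
        simpa only [this] using h3
  · rintro (h | h) i hi hij
    · exact h i hi
    · have h3 := h i hi
      have : (i < 2 * (j+1) ∧ Even i) ↔ (i < 2 * j ∧ Even i) := by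
          rw [Nat.even_iff]; omega
      simpa only [this] using h3

lemma YY_add (j r : ℕ) : YY (2*j+1+(r+1)) (2*j) + YY (2*j+1+(r+1)) (2*(j+1)) =
    (2*j+1+(r+1)).choose (2*j+1) * EE (2*j+1) := by
  classical
  rw [← card_GP]
  unfold YY
  rw [← Finset.card_union_of_disjoint]
  · congr 1
    ext σ
    simp [GP_split]
  · rw [Finset.disjoint_filter]
    intro σ _ h1 h2
    have a1 := h1 (2*j) (by omega)
    have a2 := h2 (2*j) (by omega)
    rw [if_pos ⟨by omega, by simp⟩] at a2
    rw [if_neg (by simp)] at a1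
    exact lt_asymm a1 a2

lemma EE_partial (m : ℕ) (t : ℕ) (ht : t ≤ m) :
    ∑ j ∈ range t, (-1 : ℤ) ^ j * ((2*m+1).choose (2*j+1) * EE (2*j+1)) =
      1 - (-1) ^ t * YY (2*m+1) (2*t) := by
  induction t with
  | zero => simp [YY_zero]
  | succ t ih =>
    rw [Finset.sum_range_succ, ih (by omega)]
    obtain ⟨r, hr⟩ : ∃ r, 2*m+1 = 2*t+1+(r+1) := ⟨2*m-2*t-1, by omega⟩
    have := YY_add t r
    rw [← hr] at this
    have h2 : ((YY (2*m+1) (2*t) : ℤ)) + YY (2*m+1) (2*(t+1)) =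
      (2*m+1).choose (2*t+1) * EE (2*t+1) := by exact_mod_cast this
    rw [← h2, pow_succ]; ring

lemma EE_rec (m : ℕ) :
    ∑ j ∈ range (m+1), (-1 : ℤ) ^ j * ((2*m+1).choose (2*j+1) * EE (2*j+1)) = 1 := by
  rw [Finset.sum_range_succ, EE_partial m m le_rfl, YY_top]
  simp

lemma PP_rec_odd (m : ℕ) :
    ∑ j ∈ range (m+1), ((2*m+1).choose (2*j+1) : ℤ) * PP (Fin (2*j+1)) 1 = 1 := by
  have h := PP_rec (2*m+1)
  have key : ∀ (f : ℕ → ℤ) (t : ℕ), ∑ k ∈ range (2*t), f k =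
      ∑ j ∈ range t, (f (2*j) + f (2*j+1)) := by
    intro f t
    induction t with
    | zero => simp
    | succ t ih =>
      rw [show 2*(t+1) = 2*t+1+1 by ring, Finset.sum_range_succ, Finset.sum_range_succ, ih,
        Finset.sum_range_succ]; ring
  rw [show 2*m+1+1 = 2*(m+1) by ring, key] at h
  have h2 : ∀ j ∈ range (m+1),
      (((2*m+1).choose (2*j) : ℤ) * PP (Fin (2*j)) 1 * (1 + (-1) ^ (2*m+1 - 2*j)) +
      ((2*m+1).choose (2*j+1) : ℤ) * PP (Fin (2*j+1)) 1 * (1 + (-1) ^ (2*m+1 - (2*j+1)))) =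
      2 * (((2*m+1).choose (2*j+1) : ℤ) * PP (Fin (2*j+1)) 1) := by
    intro j hj
    rw [mem_range] at hj
    rw [Odd.neg_one_pow (n := 2*m+1-2*j) ⟨m - j, by omega⟩,
      Even.neg_one_pow (n := 2*m+1-(2*j+1)) ⟨m - j, by omega⟩]
    ring
  rw [Finset.sum_congr rfl h2, ← Finset.mul_sum] at h
  linarith

lemma PP_eq (m : ℕ) : PP (Fin (2*m+1)) 1 = (-1) ^ m * EE (2*m+1) := by
  induction m using Nat.strong_induction_on with
  | _ m ih =>
    have h1 := PP_rec_odd m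
    have h2 := EE_rec m
    rw [Finset.sum_range_succ] at h1 h2
    have h3 : ∑ j ∈ range m, ((2*m+1).choose (2*j+1) : ℤ) * PP (Fin (2*j+1)) 1 =
      ∑ j ∈ range m, (-1 : ℤ) ^ j * ((2*m+1).choose (2*j+1) * EE (2*j+1)) := by
      refine Finset.sum_congr rfl fun j hj => ?_
      rw [ih j (mem_range.1 hj)]; ring
    rw [h3] at h1
    simp only [Nat.choose_self, Nat.cast_one, one_mul] at h1 h2
    linarith

end

open Classical in
/-- For odd `n`, the number of permutations with even depth minus the number with
odd depth equals the number of alternating permutations. -/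
theorem even_minus_odd_depth_eq_alternating (n : ℕ) (hn : Odd n) :
    ((Finset.univ.filter fun σ : Equiv.Perm (Fin n) => Even (depthN σ)).card : ℤ) -
      ((Finset.univ.filter fun σ : Equiv.Perm (Fin n) => ¬ Even (depthN σ)).card : ℤ) =
    (Finset.univ.filter fun σ : Equiv.Perm (Fin n) => IsAlternating σ).card := by
  obtain ⟨m, rfl⟩ := hn
  have h := even_sub (2*m+1)
  rw [depth_sum, PP_eq, ← mul_assoc, ← mul_pow] at h
  simp only [mul_neg, mul_one, neg_neg, one_pow, one_mul] at h
  have e : EE (2*m+1) =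
    (Finset.univ.filter fun σ : Equiv.Perm (Fin (2*m+1)) => IsAlternating σ).card := rfl
  rw [← e, ← h]
end
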